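/- For every simplicial set X, the unit map ν_X : X → Ex X is a weak homotopy equivalence. -/

import Mathlib

open CategoryTheory CategoryTheory.Limits Simplicial MonoidalCategory SSet

noncomputable instance : MonoidalClosed SSet.{0} :=
  (inferInstance : MonoidalClosed (SimplexCategoryᵒᵖ ⥤ Type 0))

namespace Paper

/-- A map of simplicial sets is a *trivial fibration* if it has the right lifting
property with respect to all boundary inclusions `∂Δ[n] ⟶ Δ[n]` for `n ≥ 0`. -/
def TrivialFibration {X Y : SSet.{0}} (p : X ⟶ Y) : Prop :=
  ∀ n : ℕ, HasLiftingProperty (SSet.boundary n).ι p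

/-- A map of simplicial sets is a *Kan fibration* if it has the right lifting property
with respect to all horn inclusions `Λ[n, i] ⟶ Δ[n]` for `n ≥ 1`, `0 ≤ i ≤ n`. -/
def KanFibration {X Y : SSet.{0}} (p : X ⟶ Y) : Prop :=
  ∀ (n : ℕ) (i : Fin (n + 2)), HasLiftingProperty (SSet.horn (n + 1) i).ι p

/-- An *anodyne* map is one with the left lifting property with respect to
all Kan fibrations. -/
def Anodyne {A B : SSet.{0}} (i : A ⟶ B) : Prop :=
  ∀ ⦃X Y : SSet.{0}⦄ (p : X ⟶ Y), KanFibration p → HasLiftingProperty i p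

/-- The unique map to `Δ[0]`. -/
def toPt (X : SSet.{0}) : X ⟶ Δ[0] where
  app m := ↾fun _ => SSet.stdSimplex.const 0 0 m
  naturality := by
    intro m m' φ
    refine ConcreteCategory.hom_ext _ _ fun x => ?_
    apply stdSimplex.objEquiv.injective
    apply SimplexCategory.Hom.ext
    apply OrderHom.ext
    funext j
    exact @Subsingleton.elim (Fin 1) _ _ _

/-- A *Kan complex* is a simplicial set whose map to `Δ[0]` is a Kan fibration. -/
def KanComplex (X : SSet.{0}) : Prop :=
  KanFibration (toPt X)

/-- The constant map at the vertex `k` of `Δ[1]`. -/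
def cst (X : SSet.{0}) (k : Fin 2) : X ⟶ Δ[1] where
  app m := ↾fun _ => SSet.stdSimplex.const 1 k m
  naturality := by
    intro m m' φ
    refine ConcreteCategory.hom_ext _ _ fun x => ?_
    apply stdSimplex.objEquiv.injective
    apply SimplexCategory.Hom.ext
    ext j
    rfl

/-- The endpoint inclusion `X ⟶ X ⊗ Δ[1]` at the vertex `k` of `Δ[1]`. -/
noncomputable def ept (X : SSet.{0}) (k : Fin 2) : X ⟶ X ⊗ Δ[1] :=
  CartesianMonoidalCategory.lift (𝟙 X) (cst X k)

/-- A (single-step) homotopy from `f` to `g`, as a property of the pair `(f, g)`. -/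
def Homotopy {X Y : SSet.{0}} (f g : X ⟶ Y) : Prop :=
  ∃ H : X ⊗ Δ[1] ⟶ Y, ept X 0 ≫ H = f ∧ ept X 1 ≫ H = g

/-- `f` and `g` are *homotopic* if they are connected by a zig-zag of homotopies. -/
def Homotopic {X Y : SSet.{0}} (f g : X ⟶ Y) : Prop :=
  Relation.EqvGen Homotopy f g

/-- A *homotopy equivalence* of simplicial sets. -/
def HomotopyEquivalence {X Y : SSet.{0}} (f : X ⟶ Y) : Prop :=
  ∃ g : Y ⟶ X, Homotopic (f ≫ g) (𝟙 X) ∧ Homotopic (g ≫ f) (𝟙 Y)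

/-- A map `f : X ⟶ Y` is a *weak homotopy equivalence* if for every Kan complex `K`
the induced map `K^Y ⟶ K^X` on exponentials is a homotopy equivalence. -/
def WeakHomotopyEquivalence {X Y : SSet.{0}} (f : X ⟶ Y) : Prop :=
  ∀ K : SSet.{0}, KanComplex K → HomotopyEquivalence ((MonoidalClosed.pre f).app K)

/-- A homotopy `H` between maps over `B` which is *fiberwise over `B`*. -/
def FibHomotopy {B X Y : SSet.{0}} (pX : X ⟶ B) (pY : Y ⟶ B) (f g : X ⟶ Y) : Prop :=
  ∃ H : X ⊗ Δ[1] ⟶ Y, ept X 0 ≫ H = f ∧ ept X 1 ≫ H = g ∧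
    H ≫ pY = CartesianMonoidalCategory.fst X Δ[1] ≫ pX

/-- Connectedness by a zig-zag of fiberwise homotopies over `B`. -/
def FibHomotopic {B X Y : SSet.{0}} (pX : X ⟶ B) (pY : Y ⟶ B) (f g : X ⟶ Y) : Prop :=
  Relation.EqvGen (FibHomotopy pX pY) f g

/-- A *fiberwise homotopy equivalence over `B`*. -/
def FibHomotopyEquivalence {B X Y : SSet.{0}} (pX : X ⟶ B) (pY : Y ⟶ B) (f : X ⟶ Y) : Prop :=
  f ≫ pY = pX ∧ ∃ g : Y ⟶ X, g ≫ pX = pY ∧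
    FibHomotopic pX pX (f ≫ g) (𝟙 X) ∧ FibHomotopic pY pY (g ≫ f) (𝟙 Y)

end Paper

namespace Paper

/-- The barycentric subdivision poset `sd [m]` of nonempty subsets of `[m]`,
ordered by inclusion. -/
def sd (m : SimplexCategory) : Type :=
  {S : Finset (Fin (m.len + 1)) // S.Nonempty}

instance (m : SimplexCategory) : PartialOrder (sd m) :=
  inferInstanceAs (PartialOrder {S : Finset (Fin (m.len + 1)) // S.Nonempty})

/-- The action of a simplicial operator on the subdivision posets, by taking images. -/
def sdMap {m n : SimplexCategory} (f : m ⟶ n) : sd m →o sd n where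
  toFun S := ⟨S.1.image f.toOrderHom, S.2.image _⟩
  monotone' := fun S T h => Finset.image_subset_image h

/-- Barycentric subdivision of simplices, as a functor to `Cat`. -/
def sdFunctor : SimplexCategory ⥤ Cat.{0, 0} where
  obj m := Cat.of (sd m)
  map f := (sdMap f).monotone.functor.toCatHom
  map_id m := by
    have hobj : ∀ S : sd m, (sdMap (𝟙 m)).monotone.functor.obj S = S := by
      intro S
      apply Subtype.ext
      exact Finset.image_id
    apply Cat.Hom.ext
    apply CategoryTheory.Functor.ext hobj
  map_comp {a b c} f g := by
    have hobj : ∀ S : sd a, (sdMap (f ≫ g)).monotone.functor.obj S =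
        ((sdMap f).monotone.functor ⋙ (sdMap g).monotone.functor).obj S := by
      intro S
      apply Subtype.ext
      exact (Finset.image_image (s := S.1) (f := f.toOrderHom) (g := g.toOrderHom)).symm
    apply Cat.Hom.ext
    apply CategoryTheory.Functor.ext hobj

/-- `Sd Δ[m] = N(sd [m])`, functorially in `[m]`. -/
def SdS : SimplexCategory ⥤ SSet.{0} := sdFunctor ⋙ nerveFunctor

/-- Kan's functor `Ex`, right adjoint to subdivision: `(Ex X)_m = Hom(Sd Δ[m], X)`. -/
def Ex : SSet.{0} ⥤ SSet.{0} where
  obj X := SdS.op ⋙ yoneda.obj X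
  map f := Functor.whiskerLeft SdS.op (yoneda.map f)

/-- The simplicial operator `[e] ⟶ [m]` taking `i` to the maximum of the `i`-th
subset in a chain of subsets of `[m]`. -/
def maxChain {m : SimplexCategory} {e : ℕ} (c : ComposableArrows (sd m) e) :
    (⦋e⦌ : SimplexCategory) ⟶ m :=
  SimplexCategory.Hom.mk
    { toFun := fun i => (c.obj i).1.max' (c.obj i).2
      monotone' := fun i j hij => Finset.max'_subset _ (leOfHom (c.map (homOfLE hij))) }

/-- The natural map `ν_X : X ⟶ Ex X`, adjoint transpose of `μ : Sd ⟶ id`. -/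
def nu (X : SSet.{0}) : X ⟶ Ex.obj X where
  app m := ↾fun x =>
    { app := fun k => ↾fun c => X.map (maxChain c).op x
      naturality := by
        intro k k' β
        refine ConcreteCategory.hom_ext _ _ fun c => ?_
        show X.map (maxChain (c.whiskerLeft (SimplexCategory.toCat.map β.unop).toFunctor)).op x
          = X.map β (X.map (maxChain c).op x)
        rw [← Functor.map_comp_apply]
        congr 1 }
  naturality := by
    intro m m' γ
    refine ConcreteCategory.hom_ext _ _ fun x => ?_
    apply NatTrans.ext
    funext k
    refine ConcreteCategory.hom_ext _ _ fun c => ?_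
    show X.map (maxChain c).op (X.map γ x)
      = X.map (maxChain ((SdS.map γ.unop).app k c)).op x
    have h : maxChain ((SdS.map γ.unop).app k c) = maxChain c ≫ γ.unop := by
      apply SimplexCategory.Hom.ext
      apply OrderHom.ext
      funext i
      apply le_antisymm
      · apply Finset.max'_le
        · exact (((SdS.map γ.unop).app k c).obj i).2
        intro y hy
        obtain ⟨a, ha, rfl⟩ := Finset.mem_image.mp hy
        exact γ.unop.toOrderHom.monotone
          (show a ≤ (c.obj i).1.max' (c.obj i).2 from Finset.le_max' _ _ ha)
      · apply Finset.le_max'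
        exact Finset.mem_image_of_mem _ (Finset.max'_mem (c.obj i).1 (c.obj i).2)
    rw [h, op_comp, Functor.map_comp_apply]
    rfl

/-- The iterates `Ex^k X`. -/
def ExIter (X : SSet.{0}) : ℕ → SSet.{0} := fun n => match n with
  | 0 => X
  | (n + 1) => Ex.obj (ExIter X n)

/-- The sequence `X ⟶ Ex X ⟶ Ex² X ⟶ ⋯` given by `ν`. -/
def ExInftyDiagram (X : SSet.{0}) : ℕ ⥤ SSet.{0} :=
  Functor.ofSequence (fun n => nu (ExIter X n))

/-- `Ex^∞ X`, the colimit of `X ⟶ Ex X ⟶ Ex² X ⟶ ⋯`. -/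
noncomputable def ExInfty (X : SSet.{0}) : SSet.{0} :=
  colimit (ExInftyDiagram X)

/-- The canonical map `ν^∞ : X ⟶ Ex^∞ X`. -/
noncomputable def nuInfty (X : SSet.{0}) : X ⟶ ExInfty X :=
  colimit.ι (ExInftyDiagram X) 0

end Paper


namespace Paper

/-- The natural map `Ex A ⊗ L ⟶ Ex (A ⊗ L)` given by the strength of `Ex`. -/
noncomputable def exStrength (A L : SSet.{0}) : Ex.obj A ⊗ L ⟶ Ex.obj (A ⊗ L) where
  app m := ↾fun x => CartesianMonoidalCategory.lift x.1 ((nu L).app m x.2)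
  naturality := by
    intro m m' γ
    refine ConcreteCategory.hom_ext _ _ fun x => ?_
    have h := NatTrans.naturality_apply (nu L) γ x.2
    change CartesianMonoidalCategory.lift (SdS.map γ.unop ≫ x.1) ((nu L).app m' (L.map γ x.2)) =
      SdS.map γ.unop ≫ CartesianMonoidalCategory.lift x.1 ((nu L).app m x.2)
    exact (congrArg (CartesianMonoidalCategory.lift (SdS.map γ.unop ≫ x.1)) h).trans
      (CartesianMonoidalCategory.comp_lift (SdS.map γ.unop) x.1 ((nu L).app m x.2)).symm

lemma nu_naturality {X Y : SSet.{0}} (f : X ⟶ Y) : f ≫ nu Y = nu X ≫ Ex.map f := by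
  ext m x
  apply NatTrans.ext
  funext k
  refine ConcreteCategory.hom_ext _ _ fun c => ?_
  exact (NatTrans.naturality_apply f (maxChain c).op x).symm

lemma nu_whiskerRight_exStrength (A L : SSet.{0}) :
    nu A ▷ L ≫ exStrength A L = nu (A ⊗ L) := by
  ext m x
  rfl

lemma exStrength_naturality_left {A B : SSet.{0}} (f : A ⟶ B) (L : SSet.{0}) :
    Ex.map f ▷ L ≫ exStrength B L = exStrength A L ≫ Ex.map (f ▷ L) := by
  ext m x
  rfl

lemma exStrength_naturality_right (A : SSet.{0}) {L M : SSet.{0}} (g : L ⟶ M) :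
    Ex.obj A ◁ g ≫ exStrength A M = exStrength A L ≫ Ex.map (A ◁ g) := by
  ext m x
  apply NatTrans.ext
  funext k
  refine ConcreteCategory.hom_ext _ _ fun c => ?_
  refine Prod.ext rfl ?_
  change M.map (maxChain c).op (g.app m x.2) = g.app k (L.map (maxChain c).op x.2)
  exact (NatTrans.naturality_apply g (maxChain c).op _).symm

/-- The maximum of a nonempty subset of `[m]`. -/
def sdMax {m : SimplexCategory} (S : sd m) : Fin (m.len + 1) := S.1.max' S.2

lemma sdMax_mono {m : SimplexCategory} : Monotone (sdMax (m := m)) :=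
  fun S _ h => Finset.max'_subset S.2 h

lemma sdMax_sdMap {m n : SimplexCategory} (f : m ⟶ n) (S : sd m) :
    sdMax (sdMap f S) = f.toOrderHom (sdMax S) := by
  apply le_antisymm
  · refine Finset.max'_le _ _ _ fun y hy => ?_
    obtain ⟨a, ha, rfl⟩ := Finset.mem_image.mp hy
    exact f.toOrderHom.monotone (Finset.le_max' _ _ ha)
  · exact Finset.le_max' _ _ (Finset.mem_image_of_mem _ (Finset.max'_mem S.1 S.2))

lemma sdMap_sdMap {m n k : SimplexCategory} (f : m ⟶ n) (g : n ⟶ k) (S : sd m) :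
    sdMap g (sdMap f S) = sdMap (f ≫ g) S :=
  Subtype.ext (Finset.image_image (s := S.1) (f := f.toOrderHom) (g := g.toOrderHom))

/-- The simplicial operator given by the maxima of the members of a chain of subsets. -/
def sdMaxHom {m k : SimplexCategory} (c : Fin (k.len + 1) →o sd m) : k ⟶ m :=
  SimplexCategory.Hom.mk ⟨fun j => sdMax (c j), sdMax_mono.comp c.monotone⟩

lemma sdMaxHom_sdMap {m n k : SimplexCategory} (c : Fin (k.len + 1) →o sd m) (β : m ⟶ n) :
    sdMaxHom ((sdMap β).comp c) = sdMaxHom c ≫ β :=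
  SimplexCategory.Hom.ext _ _ (OrderHom.ext _ _ (funext fun j => sdMax_sdMap β (c j)))

/-- For `c` a chain of subsets of `[m]` and `t : [m] → [1]`, the monotone map `sd [k] → sd [m]`
sending `D` to the set of maxima of the members of `c` indexed by `D`, or to the largest member of
`c` indexed by `D`, according to the value of `t` on the maximum of the latter. -/
def sdInterpolate {m k : SimplexCategory} (c : Fin (k.len + 1) →o sd m)
    (t : Fin (m.len + 1) →o Fin 2) : sd k →o sd m where
  toFun D := if t (sdMax (c (sdMax D))) = 0 then
      sdMap (sdMaxHom c) D
    else c (sdMax D)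
  monotone' D E hDE := by
    have hle : c (sdMax D) ≤ c (sdMax E) := c.monotone (sdMax_mono hDE)
    have htop := t.monotone (sdMax_mono hle)
    beta_reduce
    by_cases h₁ : t (sdMax (c (sdMax D))) = 0
    · rw [if_pos h₁]
      by_cases h₂ : t (sdMax (c (sdMax E))) = 0
      · rw [if_pos h₂]
        exact (sdMap _).monotone hDE
      · rw [if_neg h₂]
        intro x hx
        obtain ⟨j, hj, rfl⟩ := Finset.mem_image.mp hx
        exact c.monotone (Finset.le_max' _ _ (hDE hj)) (Finset.max'_mem (c j).1 (c j).2)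
    · have h₂ : t (sdMax (c (sdMax E))) ≠ 0 := fun h => h₁ (le_antisymm (h ▸ htop) (Fin.zero_le _))
      rw [if_neg h₁, if_neg h₂]
      exact hle

lemma sdInterpolate_sdMap {m k l : SimplexCategory} (c : Fin (k.len + 1) →o sd m)
    (t : Fin (m.len + 1) →o Fin 2) (θ : l ⟶ k) (D : sd l) :
    sdInterpolate (c.comp θ.toOrderHom) t D = sdInterpolate c t (sdMap θ D) := by
  change (if t (sdMax (c (θ.toOrderHom (sdMax D)))) = 0 then _ else _) =
    if t (sdMax (c (sdMax (sdMap θ D)))) = 0 then _ else c (sdMax (sdMap θ D))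
  rw [sdMax_sdMap, sdMap_sdMap]
  rfl

lemma sdInterpolate_comp {m n k : SimplexCategory} (c : Fin (k.len + 1) →o sd m)
    (t : Fin (n.len + 1) →o Fin 2) (β : m ⟶ n) (D : sd k) :
    sdInterpolate ((sdMap β).comp c) t D = sdMap β (sdInterpolate c (t.comp β.toOrderHom) D) := by
  change (if t (sdMax (sdMap β (c (sdMax D)))) = 0 then
    sdMap (sdMaxHom ((sdMap β).comp c)) D else _) =
    sdMap β (if t (β.toOrderHom (sdMax (c (sdMax D)))) = 0 then _ else _)
  rw [sdMax_sdMap, sdMaxHom_sdMap, ← sdMap_sdMap]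
  split_ifs <;> rfl

lemma sdInterpolate_of_eq_zero {m k : SimplexCategory} (c : Fin (k.len + 1) →o sd m)
    (t : Fin (m.len + 1) →o Fin 2) (ht : ∀ i, t i = 0) (D : sd k) :
    sdInterpolate c t D =
      sdMap (sdMaxHom c) D :=
  if_pos (ht _)

lemma sdInterpolate_of_eq_one {m k : SimplexCategory} (c : Fin (k.len + 1) →o sd m)
    (t : Fin (m.len + 1) →o Fin 2) (ht : ∀ i, t i = 1) (D : sd k) :
    sdInterpolate c t D = c (sdMax D) :=
  if_neg (by simp [ht])

/-- The monotone map underlying a simplex of the nerve of a preorder. -/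
def chainHom {P : Type} [PartialOrder P] {k : ℕ} (c : ComposableArrows P k) : Fin (k + 1) →o P :=
  ⟨c.obj, c.monotone⟩

/-- The map of nerves induced by a monotone map. -/
def nerveHom {P Q : Type} [PartialOrder P] [PartialOrder Q] (f : P →o Q) : nerve P ⟶ nerve Q :=
  nerveMap f.monotone.functor

/-- The homotopy `Ex X ⊗ Δ[1] ⟶ Ex (Ex X)` from `ν_{Ex X}` to `Ex ν_X`. -/
noncomputable def exHomotopy (X : SSet.{0}) : Ex.obj X ⊗ Δ[1] ⟶ Ex.obj (Ex.obj X) where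
  app m := ↾fun x =>
    { app := fun k => ↾fun c =>
        nerveHom (P := sd k.unop) (Q := sd m.unop)
          (sdInterpolate (chainHom (P := sd m.unop) c) (stdSimplex.asOrderHom x.2)) ≫
          (show SdS.obj m.unop ⟶ X from x.1)
      naturality := by
        intro k k' θ
        refine ConcreteCategory.hom_ext _ _ fun c => ?_
        apply NatTrans.ext
        funext l
        refine ConcreteCategory.hom_ext _ _ fun d => ?_
        refine congrArg (NatTrans.app (show SdS.obj m.unop ⟶ X from x.1) l) ?_
        refine nerve.ext_of_isThin (C := sd m.unop) ?_
        funext i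
        exact sdInterpolate_sdMap (chainHom (P := sd m.unop) c) (stdSimplex.asOrderHom x.2)
          θ.unop (d.obj i) }
  naturality := by
    intro m m' β
    refine ConcreteCategory.hom_ext _ _ fun x => ?_
    apply NatTrans.ext
    funext k
    refine ConcreteCategory.hom_ext _ _ fun c => ?_
    apply NatTrans.ext
    funext l
    refine ConcreteCategory.hom_ext _ _ fun d => ?_
    refine congrArg (NatTrans.app (show SdS.obj m.unop ⟶ X from x.1) l) ?_
    refine nerve.ext_of_isThin (C := sd m.unop) ?_
    funext i
    exact (sdInterpolate_comp (chainHom (P := sd m'.unop) c) (stdSimplex.asOrderHom x.2)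
      β.unop (d.obj i)).symm

lemma ept_zero_exHomotopy (X : SSet.{0}) :
    ept (Ex.obj X) 0 ≫ exHomotopy X = nu (Ex.obj X) := by
  ext m x
  apply NatTrans.ext
  funext k
  refine ConcreteCategory.hom_ext _ _ fun c => ?_
  apply NatTrans.ext
  funext l
  refine ConcreteCategory.hom_ext _ _ fun d => ?_
  refine congrArg (NatTrans.app (show SdS.obj m.unop ⟶ X from x) l) ?_
  refine nerve.ext_of_isThin (C := sd m.unop) ?_
  funext i
  exact sdInterpolate_of_eq_zero (chainHom (P := sd m.unop) c)
    (stdSimplex.asOrderHom (stdSimplex.const.{0} 1 0 m)) (fun _ => rfl) (d.obj i)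

lemma ept_one_exHomotopy (X : SSet.{0}) :
    ept (Ex.obj X) 1 ≫ exHomotopy X = Ex.map (nu X) := by
  ext m x
  apply NatTrans.ext
  funext k
  refine ConcreteCategory.hom_ext _ _ fun c => ?_
  apply NatTrans.ext
  funext l
  refine ConcreteCategory.hom_ext _ _ fun d => ?_
  refine Eq.trans ?_
    (NatTrans.naturality_apply (show SdS.obj m.unop ⟶ X from x) (maxChain d).op c)
  refine congrArg (NatTrans.app (show SdS.obj m.unop ⟶ X from x) l) ?_
  refine nerve.ext_of_isThin (C := sd m.unop) ?_
  funext i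
  exact sdInterpolate_of_eq_one (chainHom (P := sd m.unop) c)
    (stdSimplex.asOrderHom (stdSimplex.const.{0} 1 1 m)) (fun _ => rfl) (d.obj i)

section

variable {K : SSet.{0}} (r : Ex.obj K ⟶ K)

/-- The map `K^X ⟶ K^(Ex X)` induced by a map `r : Ex K ⟶ K`. -/
noncomputable def extendAlongNu (X : SSet.{0}) : (ihom X).obj K ⟶ (ihom (Ex.obj X)).obj K :=
  MonoidalClosed.curry (exStrength X ((ihom X).obj K) ≫ Ex.map ((ihom.ev X).app K) ≫ r)

lemma extendAlongNu_pre (hr : nu K ≫ r = 𝟙 K) (X : SSet.{0}) :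
    extendAlongNu r X ≫ (MonoidalClosed.pre (nu X)).app K = 𝟙 ((ihom X).obj K) := by
  apply MonoidalClosed.uncurry_injective
  rw [MonoidalClosed.uncurry_id_eq_ev, MonoidalClosed.uncurry_pre_app, extendAlongNu,
    MonoidalClosed.uncurry_curry, ← Category.assoc, nu_whiskerRight_exStrength,
    ← Category.assoc, ← nu_naturality, Category.assoc]
  exact (congrArg (_ ≫ ·) hr).trans (Category.comp_id _)

lemma pre_extendAlongNu (X : SSet.{0}) :
    (MonoidalClosed.pre (nu X)).app K ≫ extendAlongNu r X =
      MonoidalClosed.curry (Ex.map (nu X) ▷ ((ihom (Ex.obj X)).obj K) ≫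
        exStrength (Ex.obj X) _ ≫ Ex.map ((ihom.ev (Ex.obj X)).app K) ≫ r) := by
  rw [extendAlongNu, ← MonoidalClosed.curry_natural_left]
  refine congrArg _ ?_
  rw [← Category.assoc, exStrength_naturality_right, ← Category.assoc (_ ▷ _),
    exStrength_naturality_left, Category.assoc, Category.assoc, ← Functor.map_comp_assoc,
    ← Functor.map_comp_assoc, MonoidalClosed.id_tensor_pre_app_comp_ev]

lemma homotopy_pre_extendAlongNu (hr : nu K ≫ r = 𝟙 K) (X : SSet.{0}) :
    Homotopy (𝟙 _) ((MonoidalClosed.pre (nu X)).app K ≫ extendAlongNu r X) := by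
  let L := (ihom (Ex.obj X)).obj K
  let E : Ex.obj X ⊗ (L ⊗ Δ[1]) ⟶ (Ex.obj X ⊗ Δ[1]) ⊗ L :=
    CartesianMonoidalCategory.lift
      (Ex.obj X ◁ CartesianMonoidalCategory.snd L Δ[1])
      (CartesianMonoidalCategory.snd _ _ ≫ CartesianMonoidalCategory.fst L Δ[1])
  have hE (k : Fin 2) : Ex.obj X ◁ ept L k ≫ E = ept (Ex.obj X) k ▷ L := by
    ext m x <;> rfl
  refine ⟨MonoidalClosed.curry (E ≫ exHomotopy X ▷ L ≫ exStrength (Ex.obj X) L ≫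
    Ex.map ((ihom.ev (Ex.obj X)).app K) ≫ r), ?_, ?_⟩
  · rw [← MonoidalClosed.curry_natural_left, MonoidalClosed.curry_eq_iff,
      MonoidalClosed.uncurry_id_eq_ev, ← Category.assoc, hE, ← comp_whiskerRight_assoc,
      ept_zero_exHomotopy, ← Category.assoc, nu_whiskerRight_exStrength, ← Category.assoc,
      ← nu_naturality, Category.assoc]
    exact (congrArg (_ ≫ ·) hr).trans (Category.comp_id _)
  · rw [← MonoidalClosed.curry_natural_left, pre_extendAlongNu, ← Category.assoc, hE,
      ← comp_whiskerRight_assoc, ept_one_exHomotopy]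

lemma homotopyEquivalence_pre_nu (hr : nu K ≫ r = 𝟙 K) (X : SSet.{0}) :
    HomotopyEquivalence ((MonoidalClosed.pre (nu X)).app K) :=
  ⟨extendAlongNu r X, .symm _ _ (.rel _ _ (homotopy_pre_extendAlongNu r hr X)),
    by rw [extendAlongNu_pre r hr]; exact .refl _⟩

end

section

open Classical in
/-- The set of vertices of a simplex of the nerve of a partially ordered type. -/
noncomputable def chainVertices {P : Type} [PartialOrder P] (x : (nerve P).S) : Finset P :=
  Finset.univ.image x.simplex.obj

variable {P : Type} [PartialOrder P]

lemma mem_chainVertices (x : (nerve P).S) (a : P) :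
    a ∈ chainVertices x ↔ ∃ i, x.simplex.obj i = a := by
  simp [chainVertices]

lemma strictMono_simplex (x : (nerve P).N) : StrictMono x.simplex.obj :=
  (PartialOrder.mem_nerve_nonDegenerate_iff_strictMono _).1 x.nonDegenerate

lemma card_chainVertices (x : (nerve P).N) : (chainVertices x.toS).card = x.dim + 1 := by
  classical
  rw [chainVertices, Finset.card_image_of_injective _ (strictMono_simplex x).injective]
  simp

lemma isChain_chainVertices (x : (nerve P).S) : IsChain (· ≤ ·) (chainVertices x : Set P) := by
  intro a ha b hb _
  obtain ⟨i, rfl⟩ := (mem_chainVertices x a).1 ha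
  obtain ⟨j, rfl⟩ := (mem_chainVertices x b).1 hb
  exact (le_total i j).imp (fun h => x.simplex.monotone h) (fun h => x.simplex.monotone h)

lemma N_le_iff_chainVertices_subset (x y : (nerve P).N) :
    x ≤ y ↔ chainVertices x.toS ⊆ chainVertices y.toS := by
  rw [N.le_iff_exists_mono]
  constructor
  · rintro ⟨f, _, hf⟩ a ha
    obtain ⟨i, rfl⟩ := (mem_chainVertices _ a).1 ha
    exact (mem_chainVertices _ _).2 ⟨f.toOrderHom i, congrArg (fun z => z.obj i) hf⟩
  · intro h
    have h' (i) : ∃ j, y.simplex.obj j = x.simplex.obj i :=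
      (mem_chainVertices _ _).1 (h ((mem_chainVertices _ _).2 ⟨i, rfl⟩))
    choose f hf using h'
    have hmono : StrictMono f := fun i j hij => by
      rw [← (strictMono_simplex y).lt_iff_lt, hf, hf]
      exact strictMono_simplex x hij
    refine ⟨SimplexCategory.Hom.mk ⟨f, hmono.monotone⟩, ?_, ?_⟩
    · rw [SimplexCategory.mono_iff_injective]
      exact hmono.injective
    · refine nerve.ext_of_isThin (C := P) ?_
      funext i
      exact hf i

lemma N_eq_of_chainVertices_eq {x y : (nerve P).N}
    (h : chainVertices x.toS = chainVertices y.toS) : x = y :=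
  le_antisymm ((N_le_iff_chainVertices_subset x y).2 h.subset)
    ((N_le_iff_chainVertices_subset y x).2 h.symm.subset)

lemma exists_chainVertices_eq (F : Finset P) (hF : IsChain (· ≤ ·) (F : Set P))
    (hF' : F.Nonempty) : ∃ x : (nerve P).N, chainVertices x.toS = F := by
  classical
  obtain ⟨n, hn⟩ : ∃ n, F.card = n + 1 := ⟨F.card - 1, by have := hF'.card_pos; omega⟩
  let _ : LinearOrder F :=
    { (inferInstance : PartialOrder F) with
      le_total := fun a b => hF.total a.2 b.2
      toDecidableLE := Classical.decRel _ }
  let e : Fin (n + 1) ≃o F := Fintype.orderIsoFinOfCardEq F (by simpa using hn)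
  have he : StrictMono (fun i => (e i : P)) := fun i j hij => e.strictMono hij
  refine ⟨N.mk (n := n) (he.monotone.functor : ComposableArrows P n)
    ((PartialOrder.mem_nerve_nonDegenerate_iff_strictMono _).2 he), ?_⟩
  ext a
  rw [mem_chainVertices]
  constructor
  · rintro ⟨i, rfl⟩
    exact (e i).2
  · intro ha
    exact ⟨e.symm ⟨a, ha⟩, congrArg Subtype.val (e.apply_symm_apply ⟨a, ha⟩)⟩

lemma isUniquelyCodimOneFace_of_chainVertices_subset (x y : (nerve P).N)
    (h : chainVertices x.toS ⊆ chainVertices y.toS)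
    (hc : (chainVertices y.toS).card = (chainVertices x.toS).card + 1) :
    S.IsUniquelyCodimOneFace x.toS y.toS := by
  refine ⟨by simpa [card_chainVertices] using hc, ?_⟩
  obtain ⟨f, hf, hf'⟩ := N.le_iff_exists_mono.1 ((N_le_iff_chainVertices_subset x y).2 h)
  refine ⟨f, ⟨hf, hf'⟩, ?_⟩
  rintro g ⟨_, hg⟩
  apply SimplexCategory.Hom.ext
  apply OrderHom.ext
  funext i
  apply (strictMono_simplex y).injective
  exact congrArg (fun z : ComposableArrows P x.dim => z.obj i) (hg.trans hf'.symm)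

lemma exists_subcomplexN {p : Finset P → Prop} {A : (nerve P).Subcomplex}
    (hA : ∀ x : (nerve P).S, x.simplex ∉ A.obj _ ↔ p (chainVertices x))
    (F : Finset P) (hF : IsChain (· ≤ ·) (F : Set P)) (hp : p F)
    (hne : F.Nonempty) : ∃ x : A.N, chainVertices x.toS = F := by
  obtain ⟨x, hx⟩ := exists_chainVertices_eq F hF hne
  exact ⟨Subcomplex.N.mk' x ((hA x.toS).2 (by rwa [hx])), hx⟩

lemma subcomplexN_ext {A : (nerve P).Subcomplex} {x y : A.N}
    (h : chainVertices x.toS = chainVertices y.toS) : x = y :=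
  (Subcomplex.N.ext_iff x y).2 (N_eq_of_chainVertices_eq h)

/-- A matching on the finite chains satisfying a predicate, given by adding or removing an element
which depends on the chain. The function `rank` shows that the matching is acyclic. -/
structure ChainMatching [DecidableEq P] (p : Finset P → Prop) where
  pivot : Finset P → P
  rankType : Type
  [partialOrder : PartialOrder rankType]
  [wellFounded : WellFoundedLT rankType]
  rank : Finset P → rankType
  nonempty : ∀ F : Finset P, IsChain (· ≤ ·) (F : Set P) → p F → F.Nonempty
  isChain_insert : ∀ F : Finset P, IsChain (· ≤ ·) (F : Set P) → p F →
    IsChain (· ≤ ·) ((insert (pivot F) F : Finset P) : Set P)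
  insert_pred : ∀ F : Finset P, IsChain (· ≤ ·) (F : Set P) → p F → p (insert (pivot F) F)
  erase_pred : ∀ F : Finset P, IsChain (· ≤ ·) (F : Set P) → p F → p (F.erase (pivot F))
  pivot_insert : ∀ F : Finset P, IsChain (· ≤ ·) (F : Set P) → p F →
    pivot (insert (pivot F) F) = pivot F
  pivot_erase : ∀ F : Finset P, IsChain (· ≤ ·) (F : Set P) → p F →
    pivot (F.erase (pivot F)) = pivot F
  rank_lt : ∀ F G : Finset P, IsChain (· ≤ ·) (F : Set P) → p F →
    IsChain (· ≤ ·) (G : Set P) → p G →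
    pivot F ∉ F → pivot G ∉ G → G ≠ F → G ⊆ insert (pivot F) F → G.card = F.card →
    rank G < rank F

namespace ChainMatching

variable [DecidableEq P] {p : Finset P → Prop} (M : ChainMatching p) {A : (nerve P).Subcomplex}
  (hA : ∀ x : (nerve P).S, x.simplex ∉ A.obj _ ↔ p (chainVertices x))

include M hA in
lemma exists_insert (x : A.N) : ∃ y : A.N,
    chainVertices y.toS = insert (M.pivot (chainVertices x.toS)) (chainVertices x.toS) :=
  exists_subcomplexN hA _ (M.isChain_insert _ (isChain_chainVertices _) ((hA x.toS).1 x.notMem))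
    (M.insert_pred _ (isChain_chainVertices _) ((hA x.toS).1 x.notMem)) (Finset.insert_nonempty _ _)

include M hA in
lemma exists_erase (x : A.N) : ∃ y : A.N,
    chainVertices y.toS = (chainVertices x.toS).erase (M.pivot (chainVertices x.toS)) := by
  have hc : IsChain (· ≤ ·) (((chainVertices x.toS).erase
      (M.pivot (chainVertices x.toS)) : Finset P) : Set P) :=
    (isChain_chainVertices x.toS).mono (Finset.coe_subset.2 (Finset.erase_subset _ _))
  have hp := M.erase_pred _ (isChain_chainVertices _) ((hA x.toS).1 x.notMem)
  exact exists_subcomplexN hA _ hc hp (M.nonempty _ hc hp)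

/-- The pairing on the nondegenerate simplices not in a subcomplex given by a matching. -/
noncomputable def pairing : A.Pairing where
  I := {x | M.pivot (chainVertices x.toS) ∈ chainVertices x.toS}
  II := {x | M.pivot (chainVertices x.toS) ∉ chainVertices x.toS}
  inter := Set.inter_compl_self _
  union := Set.union_compl_self _
  p :=
    { toFun := fun x => ⟨(M.exists_insert hA x.1).choose, by
        have h := (M.exists_insert hA x.1).choose_spec
        rw [Set.mem_ofPred_eq, h, M.pivot_insert _ (isChain_chainVertices _)
          ((hA x.1.toS).1 x.1.notMem)]
        exact Finset.mem_insert_self _ _⟩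
      invFun := fun x => ⟨(M.exists_erase hA x.1).choose, by
        have h := (M.exists_erase hA x.1).choose_spec
        rw [Set.mem_ofPred_eq, h, M.pivot_erase _ (isChain_chainVertices _)
          ((hA x.1.toS).1 x.1.notMem)]
        exact Finset.notMem_erase _ _⟩
      left_inv := fun x => by
        apply Subtype.ext
        apply subcomplexN_ext
        have h := (M.exists_insert hA x.1).choose_spec
        refine (M.exists_erase hA _).choose_spec.trans ?_
        rw [h, M.pivot_insert _ (isChain_chainVertices _) ((hA x.1.toS).1 x.1.notMem)]
        exact Finset.erase_insert x.2
      right_inv := fun x => by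
        apply Subtype.ext
        apply subcomplexN_ext
        have h := (M.exists_erase hA x.1).choose_spec
        refine (M.exists_insert hA _).choose_spec.trans ?_
        rw [h, M.pivot_erase _ (isChain_chainVertices _) ((hA x.1.toS).1 x.1.notMem)]
        exact Finset.insert_erase x.2 }

lemma chainVertices_pairing_p (x : (M.pairing hA).II) :
    chainVertices ((M.pairing hA).p x).1.toS =
      insert (M.pivot (chainVertices x.1.toS)) (chainVertices x.1.toS) :=
  (M.exists_insert hA x.1).choose_spec

instance : (M.pairing hA).IsProper where
  isUniquelyCodimOneFace x := by
    apply isUniquelyCodimOneFace_of_chainVertices_subset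
    · rw [chainVertices_pairing_p]
      exact Finset.subset_insert _ _
    · rw [chainVertices_pairing_p]
      exact Finset.card_insert_of_notMem x.2

include M hA in
lemma anodyneExtensions_ι : anodyneExtensions A.ι := by
  let _ := M.partialOrder
  have := M.wellFounded
  let R : (M.pairing hA).WeakRankFunction M.rankType :=
    { rank := fun x => M.rank (chainVertices x.1.toS)
      lt := by
        rintro x y ⟨hne, hlt⟩ hdim
        refine M.rank_lt _ _ (isChain_chainVertices _) ((hA y.1.toS).1 y.1.notMem)
          (isChain_chainVertices _) ((hA x.1.toS).1 x.1.notMem) y.2 x.2 ?_ ?_ ?_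
        · exact fun h => hne (Subtype.ext (subcomplexN_ext h))
        · rw [← M.chainVertices_pairing_p hA y]
          exact (N_le_iff_chainVertices_subset _ _).1 (Subcomplex.N.le_iff.1 hlt.le)
        · rw [card_chainVertices, card_chainVertices, hdim] }
  have := R.isRegular
  exact (M.pairing hA).anodyneExtensions

end ChainMatching

end

/-- The mapping cylinder of `max : sd [m] → [m]`, a partially ordered type. -/
def maxCylinder (m : SimplexCategory) : Type := sd m ⊕ Fin (m.len + 1)

namespace maxCylinder

variable {m n : SimplexCategory}

/-- The inclusion of `sd [m]` in the mapping cylinder. -/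
abbrev sub (S : sd m) : maxCylinder m := Sum.inl S

/-- The inclusion of `[m]` in the mapping cylinder. -/
abbrev pt (i : Fin (m.len + 1)) : maxCylinder m := Sum.inr i

@[elab_as_elim]
protected lemma cases {motive : maxCylinder m → Prop} (sub : ∀ S, motive (sub S))
    (pt : ∀ i, motive (pt i)) (z : maxCylinder m) : motive z :=
  Sum.rec sub pt z

/-- The embedding which defines the partial order on the mapping cylinder. -/
def toProd (z : maxCylinder m) : Finset (Fin (m.len + 1)) × Bool :=
  Sum.elim (fun S => (S.1, false)) (fun i => (Finset.Iic i, true)) z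

lemma toProd_injective : Function.Injective (toProd (m := m)) := by
  rintro (S | i) (T | j) h
  · exact congrArg sub (Subtype.ext (congrArg Prod.fst h))
  · exact absurd (congrArg Prod.snd h) Bool.false_ne_true
  · exact absurd (congrArg Prod.snd h).symm Bool.false_ne_true
  · exact congrArg pt (le_antisymm (Finset.Iic_subset_Iic.1 (congrArg Prod.fst h).le)
      (Finset.Iic_subset_Iic.1 (congrArg Prod.fst h).ge))

instance : PartialOrder (maxCylinder m) := PartialOrder.lift toProd toProd_injective

noncomputable instance : DecidableEq (maxCylinder m) := Classical.decEq _

lemma sub_le_sub {S T : sd m} : sub S ≤ sub T ↔ S ≤ T :=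
  ⟨fun h => h.1, fun h => ⟨h, le_rfl⟩⟩

lemma sub_le_pt {S : sd m} {i : Fin (m.len + 1)} : sub S ≤ pt i ↔ ∀ j ∈ S.1, j ≤ i :=
  ⟨fun h _ hj => Finset.mem_Iic.1 (h.1 hj),
    fun h => ⟨fun j hj => Finset.mem_Iic.2 (h j hj), Bool.false_le _⟩⟩

lemma pt_le_pt {i j : Fin (m.len + 1)} : pt i ≤ pt j ↔ i ≤ j :=
  ⟨fun h => Finset.Iic_subset_Iic.1 h.1, fun h => ⟨Finset.Iic_subset_Iic.2 h, le_rfl⟩⟩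

lemma not_pt_le_sub {i : Fin (m.len + 1)} {S : sd m} : ¬ pt i ≤ sub S :=
  fun h => absurd (show true ≤ false from h.2) (by decide)

lemma pt_ne_sub {i : Fin (m.len + 1)} {S : sd m} : pt i ≠ sub S := Sum.inr_ne_inl

/-- The set of vertices of `[m]` involved in an element of the mapping cylinder. -/
def support (z : maxCylinder m) : Finset (Fin (m.len + 1)) := Sum.elim (fun S => S.1) ({·}) z

/-- The property, for a finite chain in the mapping cylinder, to meet `[m]` and to involve all the
vertices of `[m]`. -/
def IsFull (F : Finset (maxCylinder m)) : Prop :=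
  (∃ i, pt i ∈ F) ∧ ∀ i, ∃ z ∈ F, i ∈ support z

/-- The least element of `[m]` in a finite subset of the mapping cylinder. -/
noncomputable def least (F : Finset (maxCylinder m)) : Fin (m.len + 1) :=
  (Finset.univ.filter fun i => pt i ∈ F).inf id

lemma least_le {F : Finset (maxCylinder m)} {i : Fin (m.len + 1)} (hi : pt i ∈ F) :
    least F ≤ i :=
  Finset.inf_le (f := id) (Finset.mem_filter.2 ⟨Finset.mem_univ _, hi⟩)

lemma pt_least_mem {F : Finset (maxCylinder m)} (hF : ∃ i, pt i ∈ F) : pt (least F) ∈ F := by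
  obtain ⟨i, hi⟩ := hF
  have hne : (Finset.univ.filter fun i => pt i ∈ F).Nonempty :=
    ⟨i, Finset.mem_filter.2 ⟨Finset.mem_univ _, hi⟩⟩
  obtain ⟨j, hj, h⟩ := Finset.exists_mem_eq_inf _ hne id
  rw [least, h]
  exact (Finset.mem_filter.1 hj).2

lemma least_anti {F G : Finset (maxCylinder m)} (h : ∀ i, pt i ∈ F → pt i ∈ G) :
    least G ≤ least F :=
  Finset.inf_mono fun i hi =>
    Finset.mem_filter.2 ⟨Finset.mem_univ _, h i (Finset.mem_filter.1 hi).2⟩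

/-- The members of a finite subset of the mapping cylinder which are subsets of `[m]`
not containing the element `least`. -/
noncomputable def lower (F : Finset (maxCylinder m)) : Finset (maxCylinder m) :=
  Set.Finite.toFinset (s := {z | z ∈ F ∧ ∃ S, z = sub S ∧ least F ∉ S.1})
    (F.finite_toSet.subset fun _ h => h.1)

lemma mem_lower {F : Finset (maxCylinder m)} {z : maxCylinder m} :
    z ∈ lower F ↔ z ∈ F ∧ ∃ S, z = sub S ∧ least F ∉ S.1 :=
  Set.Finite.mem_toFinset _

/-- The set of vertices given by `least` and all the members of `lower`. -/
noncomputable def pivotSet (F : Finset (maxCylinder m)) : sd m :=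
  ⟨insert (least F) ((lower F).biUnion support), Finset.insert_nonempty _ _⟩

lemma mem_pivotSet {F : Finset (maxCylinder m)} {j : Fin (m.len + 1)} :
    j ∈ (pivotSet F).1 ↔ j = least F ∨ ∃ z ∈ lower F, j ∈ support z := by
  simp [pivotSet]

lemma least_mem_pivotSet (F : Finset (maxCylinder m)) : least F ∈ (pivotSet F).1 :=
  mem_pivotSet.2 (.inl rfl)

lemma pivotSet_congr {F G : Finset (maxCylinder m)} (h : least F = least G)
    (h' : lower F = lower G) : pivotSet F = pivotSet G := by
  apply Subtype.ext
  change insert _ (Finset.biUnion _ _) = insert _ (Finset.biUnion _ _)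
  rw [h, h']

lemma pivotSet_eq_of_erase_eq {F G : Finset (maxCylinder m)}
    (h : ∀ z, z ≠ sub (pivotSet F) → (z ∈ G ↔ z ∈ F)) : pivotSet G = pivotSet F := by
  have hl : least G = least F := le_antisymm
    (least_anti fun i hi => (h _ pt_ne_sub).2 hi) (least_anti fun i hi => (h _ pt_ne_sub).1 hi)
  refine pivotSet_congr hl (Finset.ext fun z => ?_)
  rw [mem_lower, mem_lower, hl]
  refine and_congr_left ?_
  rintro ⟨S, rfl, hS⟩
  refine h _ fun hS' => hS ?_
  rw [Sum.inl_injective hS']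
  exact least_mem_pivotSet F

lemma isChain_insert_pivotSet {F : Finset (maxCylinder m)}
    (hF : IsChain (· ≤ ·) (F : Set (maxCylinder m))) :
    IsChain (· ≤ ·) ((insert (sub (pivotSet F)) F : Finset (maxCylinder m)) :
      Set (maxCylinder m)) := by
  rw [Finset.coe_insert]
  refine hF.insert fun z hz _ => ?_
  induction z using maxCylinder.cases with
  | sub S =>
    by_cases hS : least F ∈ S.1
    · refine .inl (sub_le_sub.2 fun j hj => ?_)
      obtain rfl | ⟨w, hw, hj⟩ := mem_pivotSet.1 hj
      · exact hS
      · obtain ⟨hw, S', rfl, hS'⟩ := mem_lower.1 hw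
        obtain h | h := hF.total hw hz
        · exact sub_le_sub.1 h hj
        · exact absurd (sub_le_sub.1 h hS) hS'
    · exact .inr (sub_le_sub.2 fun j hj =>
        mem_pivotSet.2 (.inr ⟨sub S, mem_lower.2 ⟨hz, S, rfl, hS⟩, hj⟩))
  | pt i =>
    refine .inl (sub_le_pt.2 fun j hj => ?_)
    obtain rfl | ⟨w, hw, hj⟩ := mem_pivotSet.1 hj
    · exact least_le hz
    · obtain ⟨hw, S', rfl, hS'⟩ := mem_lower.1 hw
      obtain h | h := hF.total hw hz
      · exact sub_le_pt.1 h _ hj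
      · exact absurd h not_pt_le_sub

lemma IsFull.erase {F : Finset (maxCylinder m)} (hF : IsFull F) :
    IsFull (F.erase (sub (pivotSet F))) := by
  have hl : pt (least F) ∈ F.erase (sub (pivotSet F)) :=
    Finset.mem_erase.2 ⟨pt_ne_sub, pt_least_mem hF.1⟩
  refine ⟨⟨_, hl⟩, fun i => ?_⟩
  obtain ⟨z, hz, hi⟩ := hF.2 i
  by_cases hzF : z = sub (pivotSet F)
  · subst hzF
    obtain rfl | ⟨w, hw, hi⟩ := mem_pivotSet.1 hi
    · exact ⟨_, hl, Finset.mem_singleton_self _⟩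
    · refine ⟨w, Finset.mem_erase.2 ⟨?_, (mem_lower.1 hw).1⟩, hi⟩
      rintro rfl
      obtain ⟨_, S, hS, hS'⟩ := mem_lower.1 hw
      exact hS' (Sum.inl_injective hS ▸ least_mem_pivotSet F)
  · exact ⟨z, Finset.mem_erase.2 ⟨hzF, hz⟩, hi⟩

/-- The acyclic matching on the chains which are full. -/
noncomputable def matching (m : SimplexCategory) :
    ChainMatching (P := maxCylinder m) IsFull where
  pivot F := sub (pivotSet F)
  rankType := (Fin (m.len + 1))ᵒᵈ ×ₗ Finset (maxCylinder m)
  rank F := toLex (OrderDual.toDual (least F), lower F)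
  nonempty F _ hF := ⟨_, hF.1.choose_spec⟩
  isChain_insert F hF _ := isChain_insert_pivotSet hF
  insert_pred F _ hF := ⟨hF.1.imp fun i hi => Finset.mem_insert_of_mem hi,
    fun i => (hF.2 i).imp fun z hz => ⟨Finset.mem_insert_of_mem hz.1, hz.2⟩⟩
  erase_pred F _ hF := hF.erase
  pivot_insert F _ _ := congrArg sub (pivotSet_eq_of_erase_eq fun z hz => by simp [hz])
  pivot_erase F _ _ := congrArg sub (pivotSet_eq_of_erase_eq fun z hz => by simp [hz])
  rank_lt F G _ hF _ hG hF' hG' hne hsub hcard := by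
    have hmem : sub (pivotSet F) ∈ G := by
      by_contra h
      exact hne (Finset.eq_of_subset_of_card_le
        ((Finset.subset_insert_iff_of_notMem h).1 hsub) hcard.ge)
    have hl : least F ≤ least G :=
      least_anti fun i hi => Finset.mem_of_mem_insert_of_ne (hsub hi) pt_ne_sub
    rw [Prod.Lex.toLex_lt_toLex]
    obtain h | h := hl.lt_or_eq
    · exact .inl h
    · refine .inr ⟨congrArg OrderDual.toDual h.symm, ?_⟩
      refine lt_of_le_of_ne (fun z hz => ?_) fun h' => hG' ?_
      · obtain ⟨hz, S, rfl, hS⟩ := mem_lower.1 hz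
        rw [← h] at hS
        refine mem_lower.2 ⟨Finset.mem_of_mem_insert_of_ne (hsub hz) fun hS' => hS ?_, S, rfl, hS⟩
        rw [Sum.inl_injective hS']
        exact least_mem_pivotSet F
      · rwa [pivotSet_congr h.symm h']

/-- The subcomplex of the nerve of the mapping cylinder consisting of the chains which are not
full. -/
def nonFull (m : SimplexCategory) : (nerve (maxCylinder m)).Subcomplex where
  obj _ := {c | (∀ j i, (show ComposableArrows (maxCylinder m) _ from c).obj j ≠ pt i) ∨
    ∃ i, ∀ j, i ∉ support ((show ComposableArrows (maxCylinder m) _ from c).obj j)}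
  map f _ hc := hc.imp (fun h j => h (f.unop.toOrderHom j))
    (Exists.imp fun _ h j => h (f.unop.toOrderHom j))

lemma notMem_nonFull_iff (x : (nerve (maxCylinder m)).S) :
    x.simplex ∉ (nonFull m).obj _ ↔ IsFull (chainVertices x) := by
  have : x.simplex ∈ (nonFull m).obj _ ↔ (∀ j i, x.simplex.obj j ≠ pt i) ∨
    ∃ i, ∀ j, i ∉ support (x.simplex.obj j) := Iff.rfl
  rw [this, IsFull]
  push Not
  refine and_congr ?_ (forall_congr' fun i => ?_)
  · simp only [mem_chainVertices]
    exact exists_comm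
  · simp [mem_chainVertices]

lemma anodyneExtensions_nonFull_ι (m : SimplexCategory) : anodyneExtensions (nonFull m).ι :=
  (matching m).anodyneExtensions_ι notMem_nonFull_iff

end maxCylinder

namespace maxCylinder

variable {m n : SimplexCategory}

/-- The map of mapping cylinders induced by a simplicial operator. -/
def map (f : m ⟶ n) : maxCylinder m →o maxCylinder n where
  toFun := Sum.map (sdMap f) f.toOrderHom
  monotone' x y h := by
    induction x using maxCylinder.cases with
    | sub S =>
      induction y using maxCylinder.cases with
      | sub T => exact sub_le_sub.2 ((sdMap f).monotone (sub_le_sub.1 h))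
      | pt j =>
        refine sub_le_pt.2 fun a ha => ?_
        obtain ⟨b, hb, rfl⟩ := Finset.mem_image.1 ha
        exact f.toOrderHom.monotone (sub_le_pt.1 h b hb)
    | pt i =>
      induction y using maxCylinder.cases with
      | sub T => exact absurd h not_pt_le_sub
      | pt j => exact pt_le_pt.2 (f.toOrderHom.monotone (pt_le_pt.1 h))

lemma support_map (f : m ⟶ n) (z : maxCylinder m) :
    support (map f z) = (support z).image f.toOrderHom := by
  induction z using maxCylinder.cases with
  | sub S => rfl
  | pt i => exact (Finset.image_singleton _ _).symm

lemma map_congr {f g : m ⟶ n} {z : maxCylinder m}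
    (h : ∀ i ∈ support z, f.toOrderHom i = g.toOrderHom i) : map f z = map g z := by
  induction z using maxCylinder.cases with
  | sub S => exact congrArg sub (Subtype.ext (Finset.image_congr h))
  | pt i => exact congrArg pt (h i (Finset.mem_singleton_self i))

lemma map_id (z : maxCylinder m) : map (𝟙 m) z = z := by
  induction z using maxCylinder.cases with
  | sub S => exact congrArg sub (Subtype.ext Finset.image_id)
  | pt i => rfl

lemma map_map {k : SimplexCategory} (f : m ⟶ n) (g : n ⟶ k) (z : maxCylinder m) :
    map g (map f z) = map (f ≫ g) z := by
  induction z using maxCylinder.cases with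
  | sub S => exact congrArg sub (sdMap_sdMap f g S)
  | pt i => rfl

lemma map_eq_self {f : m ⟶ m} {z : maxCylinder m} (h : ∀ i ∈ support z, f.toOrderHom i = i) :
    map f z = z :=
  (map_congr (g := 𝟙 m) h).trans (map_id z)

lemma support_nonempty (z : maxCylinder m) : (support z).Nonempty := by
  induction z using maxCylinder.cases with
  | sub S => exact S.2
  | pt i => exact Finset.singleton_nonempty i

/-- The projection from the mapping cylinder to `[m]`. -/
def proj (m : SimplexCategory) : maxCylinder m →o Fin (m.len + 1) where
  toFun := Sum.elim sdMax id
  monotone' x y h := by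
    induction x using maxCylinder.cases with
    | sub S =>
      induction y using maxCylinder.cases with
      | sub T => exact sdMax_mono (sub_le_sub.1 h)
      | pt j => exact sub_le_pt.1 h _ (Finset.max'_mem S.1 S.2)
    | pt i =>
      induction y using maxCylinder.cases with
      | sub T => exact absurd h not_pt_le_sub
      | pt j => exact pt_le_pt.1 h

lemma proj_map (f : m ⟶ n) (z : maxCylinder m) :
    proj n (map f z) = f.toOrderHom (proj m z) := by
  induction z using maxCylinder.cases with
  | sub S => exact sdMax_sdMap f S
  | pt i => rfl

/-- The inclusion of `sd [m]` in the mapping cylinder as a monotone map. -/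
def subHom (m : SimplexCategory) : sd m →o maxCylinder m := ⟨sub, fun _ _ => sub_le_sub.2⟩

/-- The inclusion of `[m]` in the mapping cylinder as a monotone map. -/
def ptHom (m : SimplexCategory) : Fin (m.len + 1) →o maxCylinder m := ⟨pt, fun _ _ => pt_le_pt.2⟩

end maxCylinder

open maxCylinder

lemma nerve_hom_ext {P : Type} [PartialOrder P] {X : SSet.{0}} {f g : X ⟶ nerve P}
    (h : ∀ (k : SimplexCategoryᵒᵖ) (c : X.obj k) (i : Fin (k.unop.len + 1)),
      (show ComposableArrows P k.unop.len from f.app k c).obj i =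
        (show ComposableArrows P k.unop.len from g.app k c).obj i) : f = g :=
  NatTrans.ext (funext fun k => ConcreteCategory.hom_ext _ _ fun c =>
    nerve.ext_of_isThin (funext fun i => h k c i))

/-- The nerves of the mapping cylinders, as a cosimplicial simplicial set. -/
def cylS : SimplexCategory ⥤ SSet.{0} where
  obj m := nerve (maxCylinder m)
  map f := nerveHom (maxCylinder.map f)
  map_id _ := nerve_hom_ext fun _ c i => map_id (c.obj i)
  map_comp f g := nerve_hom_ext fun _ c i => (map_map f g (c.obj i)).symm

/-- The inclusion of the subdivisions in the nerves of the mapping cylinders. -/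
def cylIncl : SdS ⟶ cylS where
  app m := nerveHom (P := sd m) (subHom m)
  naturality _ _ _ := nerve_hom_ext fun _ _ _ => rfl

/-- The simplicial set whose `m`-simplices are the maps to `K` from the nerve of the mapping
cylinder of `max : sd [m] → [m]`. -/
def cylEx (K : SSet.{0}) : SSet.{0} := cylS.op ⋙ yoneda.obj K

/-- The restriction map `cylEx K ⟶ Ex K`. -/
def cylToEx (K : SSet.{0}) : cylEx K ⟶ Ex.obj K :=
  Functor.whiskerRight (NatTrans.op cylIncl) (yoneda.obj K)

/-- The simplicial operator given by the projections of the members of a chain. -/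
def projHom {m : SimplexCategory} {k : ℕ} (c : ComposableArrows (maxCylinder m) k) :
    (⦋k⦌ : SimplexCategory) ⟶ m :=
  SimplexCategory.Hom.mk ((proj m).comp (chainHom c))

/-- The map `K ⟶ cylEx K` induced by the projections of the mapping cylinders. -/
def toCylEx (K : SSet.{0}) : K ⟶ cylEx K where
  app m := ↾fun x =>
    { app := fun k => ↾fun c => K.map (projHom (m := m.unop) c).op x
      naturality := by
        intro k k' β
        refine ConcreteCategory.hom_ext _ _ fun c => ?_
        exact Functor.map_comp_apply K (projHom (m := m.unop) c).op β x }
  naturality := by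
    intro m m' γ
    refine ConcreteCategory.hom_ext _ _ fun x => ?_
    apply NatTrans.ext
    funext k
    refine ConcreteCategory.hom_ext _ _ fun c => ?_
    refine (Functor.map_comp_apply K γ (projHom (m := m'.unop) c).op x).symm.trans ?_
    refine congrArg (fun φ => K.map φ x) ?_
    refine congrArg Quiver.Hom.op (?_ : projHom (m := m'.unop) c ≫ γ.unop =
      projHom (m := m.unop) ((cylS.map γ.unop).app k c))
    refine SimplexCategory.Hom.ext _ _ (OrderHom.ext _ _ (funext fun i => ?_))
    exact (proj_map γ.unop _).symm

/-- The chain of the elements of `[m]` in the mapping cylinder. -/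
def ptChain (m : SimplexCategory) : ComposableArrows (maxCylinder m) m.len :=
  (ptHom m).monotone.functor

/-- The map `cylEx K ⟶ K` given by the evaluation at the end of the mapping cylinders. -/
def cylExEval (K : SSet.{0}) : cylEx K ⟶ K where
  app m := ↾fun y => (show cylS.obj m.unop ⟶ K from y).app m (ptChain m.unop)
  naturality := by
    intro m m' γ
    refine ConcreteCategory.hom_ext _ _ fun y => ?_
    refine Eq.trans ?_ (NatTrans.naturality_apply (show cylS.obj m.unop ⟶ K from y) γ
      (ptChain m.unop))
    refine congrArg ((show cylS.obj m.unop ⟶ K from y).app m') ?_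
    exact nerve.ext_of_isThin (C := maxCylinder m.unop) rfl

lemma toCylEx_cylExEval (K : SSet.{0}) : toCylEx K ≫ cylExEval K = 𝟙 K := by
  ext m x
  exact (ConcreteCategory.congr_hom (K.map_id m) x)

lemma toCylEx_cylToEx (K : SSet.{0}) : toCylEx K ≫ cylToEx K = nu K := by
  ext m x
  apply NatTrans.ext
  funext k
  refine ConcreteCategory.hom_ext _ _ fun c => ?_
  rfl

lemma toPt_eq {X : SSet.{0}} (f : X ⟶ Δ[0]) : f = toPt X := by
  ext

lemma KanFibration.hasLiftingProperty {A B X Y : SSet.{0}} {p : X ⟶ Y} (hp : KanFibration p)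
    {i : A ⟶ B} (hi : anodyneExtensions i) : HasLiftingProperty i p := by
  rw [anodyneExtensions_eq_llp_rlp] at hi
  refine hi p fun _ _ j hj => ?_
  simp only [modelCategoryQuillen.J, MorphismProperty.iSup_iff] at hj
  obtain ⟨n, ⟨k⟩⟩ := hj
  exact hp n k

lemma KanComplex.exists_extension {A B K : SSet.{0}} (hK : KanComplex K) {i : A ⟶ B}
    (hi : anodyneExtensions i) (f : A ⟶ K) : ∃ g : B ⟶ K, i ≫ g = f := by
  have := KanFibration.hasLiftingProperty hK hi
  have sq : CommSq f i (toPt K) (toPt B) := ⟨(toPt_eq _).trans (toPt_eq _).symm⟩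
  exact ⟨sq.lift, sq.fac_left⟩

open maxCylinder

section

variable {m n : SimplexCategory}

/-- A monotone retraction of `[m]` onto a nonempty subset. -/
def retractionOnto (S : Finset (Fin (m.len + 1))) (hS : S.Nonempty) : m ⟶ m :=
  SimplexCategory.Hom.mk
    { toFun := fun i => (insert (S.min' hS) (S.filter (· ≤ i))).max' (Finset.insert_nonempty _ _)
      monotone' := fun _ _ hij => Finset.max'_subset _ (Finset.insert_subset_insert _
        (Finset.monotone_filter_right S fun _ _ h => h.trans hij)) }

lemma retractionOnto_apply (S : Finset (Fin (m.len + 1))) (hS : S.Nonempty)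
    (i : Fin (m.len + 1)) : (retractionOnto S hS).toOrderHom i =
      (insert (S.min' hS) (S.filter (· ≤ i))).max' (Finset.insert_nonempty _ _) :=
  rfl

lemma retractionOnto_mem (S : Finset (Fin (m.len + 1))) (hS : S.Nonempty) (i : Fin (m.len + 1)) :
    (retractionOnto S hS).toOrderHom i ∈ S := by
  rw [retractionOnto_apply]
  have h := Finset.max'_mem (insert (S.min' hS) (S.filter (· ≤ i))) (Finset.insert_nonempty _ _)
  obtain h | h := Finset.mem_insert.1 h
  · rw [h]
    exact S.min'_mem hS
  · exact (Finset.mem_filter.1 h).1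

lemma retractionOnto_of_mem (S : Finset (Fin (m.len + 1))) (hS : S.Nonempty)
    {i : Fin (m.len + 1)} (hi : i ∈ S) : (retractionOnto S hS).toOrderHom i = i := by
  rw [retractionOnto_apply]
  apply le_antisymm
  · refine Finset.max'_le _ _ _ fun j hj => ?_
    obtain rfl | hj := Finset.mem_insert.1 hj
    · exact S.min'_le _ hi
    · exact (Finset.mem_filter.1 hj).2
  · have h : i ∈ insert (S.min' hS) (S.filter (· ≤ i)) :=
      Finset.mem_insert_of_mem (Finset.mem_filter.2 ⟨hi, le_rfl⟩)
    exact Finset.le_max' _ i h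

/-- The set of vertices of `[m]` involved in a chain in the mapping cylinder. -/
def chainSupport {k : ℕ} (c : ComposableArrows (maxCylinder m) k) : Finset (Fin (m.len + 1)) :=
  Finset.univ.biUnion fun i => support (c.obj i)

lemma mem_chainSupport {k : ℕ} {c : ComposableArrows (maxCylinder m) k} {a : Fin (m.len + 1)} :
    a ∈ chainSupport c ↔ ∃ i, a ∈ support (c.obj i) := by
  simp [chainSupport]

lemma chainSupport_nonempty {k : ℕ} (c : ComposableArrows (maxCylinder m) k) :
    (chainSupport c).Nonempty :=
  (support_nonempty (c.obj 0)).imp fun _ h => mem_chainSupport.2 ⟨0, h⟩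

lemma cylS_map_retractionOnto {k : SimplexCategoryᵒᵖ}
    (c : ComposableArrows (maxCylinder m) k.unop.len) :
    (cylS.map (retractionOnto (chainSupport c) (chainSupport_nonempty c))).app k c = c :=
  nerve.ext_of_isThin (C := maxCylinder m)
    (funext fun i => map_eq_self fun _ ha =>
      retractionOnto_of_mem _ _ (mem_chainSupport.2 ⟨i, ha⟩))

lemma mem_chainSupport_cylS_map (f : m ⟶ n) {k : SimplexCategoryᵒᵖ}
    (c : ComposableArrows (maxCylinder m) k.unop.len) {b : Fin (n.len + 1)} :
    b ∈ chainSupport (m := n) ((cylS.map f).app k c) ↔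
      ∃ a ∈ chainSupport c, f.toOrderHom a = b := by
  have : b ∈ chainSupport (m := n) ((cylS.map f).app k c) ↔
      ∃ i, b ∈ support (maxCylinder.map f (c.obj i)) := mem_chainSupport
  simp only [this, support_map, Finset.mem_image, mem_chainSupport]
  grind

lemma exists_cylIncl_eq {k : SimplexCategoryᵒᵖ} (c : ComposableArrows (maxCylinder m) k.unop.len)
    (hc : ∀ i a, c.obj i ≠ pt a) : ∃ c₀, (cylIncl.app m).app k c₀ = c := by
  have h (i) : ∃ S, sub S = c.obj i := by
    generalize hz : c.obj i = z
    induction z using maxCylinder.cases with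
    | sub S => exact ⟨S, rfl⟩
    | pt a => exact absurd hz (hc i a)
  choose S hS using h
  have hmono : Monotone S := fun i j hij => sub_le_sub.1 (by rw [hS, hS]; exact c.monotone hij)
  exact ⟨(hmono.functor : ComposableArrows (sd m) k.unop.len),
    nerve.ext_of_isThin (C := maxCylinder m) (funext hS)⟩

lemma cylIncl_injective {k : SimplexCategoryᵒᵖ} :
    Function.Injective ((cylIncl.app m).app k) := by
  intro c c' h
  refine nerve.ext_of_isThin (C := sd m) (funext fun i => ?_)
  exact Sum.inl_injective (congrArg
    (fun z : ComposableArrows (maxCylinder m) k.unop.len => z.obj i) h)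

end

section

variable {K : SSet.{0}} {n : SimplexCategory} (y : SdS.obj n ⟶ K)
  (u : ∀ (s : SimplexCategory) (γ : s ⟶ n), ¬ Function.Surjective γ.toOrderHom →
    (cylS.obj s ⟶ K))

/-- The relation describing the map to `K` from the chains which are not full that is obtained by
gluing a map on `sd [n]` and maps on the faces of the mapping cylinder. -/
def GluingRel (k : SimplexCategoryᵒᵖ) (c : (cylS.obj n).obj k) (v : K.obj k) : Prop :=
  (∃ c₀, (cylIncl.app n).app k c₀ = c ∧ v = y.app k c₀) ∨
  (∃ s γ hγ c', (cylS.map γ).app k c' = c ∧ v = (u s γ hγ).app k c')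

variable {y u}

lemma GluingRel.map {k k' : SimplexCategoryᵒᵖ} (φ : k ⟶ k') {c : (cylS.obj n).obj k} {v : K.obj k}
    (h : GluingRel y u k c v) : GluingRel y u k' ((cylS.obj n).map φ c) (K.map φ v) := by
  obtain ⟨c₀, rfl, rfl⟩ | ⟨s, γ, hγ, c', rfl, rfl⟩ := h
  · exact .inl ⟨(SdS.obj n).map φ c₀, NatTrans.naturality_apply (cylIncl.app n) φ c₀,
      (NatTrans.naturality_apply y φ c₀).symm⟩
  · exact .inr ⟨s, γ, hγ, (cylS.obj s).map φ c', NatTrans.naturality_apply (cylS.map γ) φ c',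
      (NatTrans.naturality_apply (u s γ hγ) φ c').symm⟩

lemma not_surjective_retractionOnto {k : ℕ} {c : ComposableArrows (maxCylinder n) k}
    {a : Fin (n.len + 1)} (ha : a ∉ chainSupport c) :
    ¬ Function.Surjective (retractionOnto _ (chainSupport_nonempty c)).toOrderHom := by
  intro h
  obtain ⟨b, rfl⟩ := h a
  exact ha (retractionOnto_mem _ _ _)

lemma exists_gluingRel {k : SimplexCategoryᵒᵖ} {c : (cylS.obj n).obj k}
    (hc : c ∈ (nonFull n).obj k) : ∃ v, GluingRel y u k c v := by
  obtain hc | ⟨a, ha⟩ := hc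
  · obtain ⟨c₀, hc₀⟩ := exists_cylIncl_eq (m := n) c hc
    exact ⟨_, .inl ⟨c₀, hc₀, rfl⟩⟩
  · have ha' : a ∉ chainSupport (m := n) c := fun h => by
      obtain ⟨i, hi⟩ := mem_chainSupport.1 h
      exact ha i hi
    exact ⟨_, .inr ⟨n, _, not_surjective_retractionOnto ha', c, cylS_map_retractionOnto c, rfl⟩⟩

lemma gluing_eq_of_cylIncl {s : SimplexCategory} {γ : s ⟶ n}
    (hγ : ¬ Function.Surjective γ.toOrderHom)
    (hy : cylIncl.app s ≫ u s γ hγ = SdS.map γ ≫ y) {k : SimplexCategoryᵒᵖ}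
    (c : ComposableArrows (maxCylinder s) k.unop.len) (d : (SdS.obj n).obj k)
    (hd : (cylS.map γ).app k c = (cylIncl.app n).app k d) :
    (u s γ hγ).app k c = y.app k d := by
  obtain ⟨c₀, rfl⟩ := exists_cylIncl_eq c fun i a hi => by
    have h := congrArg (fun z : ComposableArrows (maxCylinder n) k.unop.len => z.obj i) hd
    have h' : maxCylinder.map γ (c.obj i) = sub
      ((show ComposableArrows (sd n) k.unop.len from d).obj i) := h
    rw [hi] at h'
    exact pt_ne_sub h'
  refine (ConcreteCategory.congr_hom (NatTrans.congr_app hy k) c₀).trans ?_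
  refine congrArg (y.app k) (cylIncl_injective (Eq.trans ?_ hd))
  exact (ConcreteCategory.congr_hom (NatTrans.congr_app (cylIncl.naturality γ) k) c₀)

lemma cylIncl_app_mem_nonFull {k : SimplexCategoryᵒᵖ} (c₀ : (SdS.obj n).obj k) :
    (cylIncl.app n).app k c₀ ∈ (nonFull n).obj k :=
  .inl fun _ _ h => pt_ne_sub h.symm

lemma cylS_map_app_mem_nonFull {s : SimplexCategory} {γ : s ⟶ n}
    (hγ : ¬ Function.Surjective γ.toOrderHom) {k : SimplexCategoryᵒᵖ} (c : (cylS.obj s).obj k) :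
    (cylS.map γ).app k c ∈ (nonFull n).obj k := by
  obtain ⟨a, ha⟩ := not_forall.1 hγ
  refine .inr ⟨a, fun i hi => ?_⟩
  obtain ⟨b, _, hb⟩ := (mem_chainSupport_cylS_map γ c).1 (mem_chainSupport.2 ⟨i, hi⟩)
  exact ha ⟨b, hb⟩

section

variable (hu : ∀ {s t : SimplexCategory} (δ : t ⟶ s) (γ : s ⟶ n)
    (hγ : ¬ Function.Surjective γ.toOrderHom)
    (hγ' : ¬ Function.Surjective (δ ≫ γ).toOrderHom), u t (δ ≫ γ) hγ' = cylS.map δ ≫ u s γ hγ)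
  (hy : ∀ {s : SimplexCategory} (γ : s ⟶ n) (hγ : ¬ Function.Surjective γ.toOrderHom),
    cylIncl.app s ≫ u s γ hγ = SdS.map γ ≫ y)

include hu

lemma gluing_congr {s : SimplexCategory} {γ γ' : s ⟶ n}
    (hγ : ¬ Function.Surjective γ.toOrderHom) (hγ' : ¬ Function.Surjective γ'.toOrderHom)
    {k : SimplexCategoryᵒᵖ} (c : ComposableArrows (maxCylinder s) k.unop.len)
    (h : ∀ i ∈ chainSupport c, γ.toOrderHom i = γ'.toOrderHom i) :
    (u s γ hγ).app k c = (u s γ' hγ').app k c := by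
  let ρ := retractionOnto _ (chainSupport_nonempty c)
  have key (γ : s ⟶ n) (hγ : ¬ Function.Surjective γ.toOrderHom)
      (hγ' : ¬ Function.Surjective (ρ ≫ γ).toOrderHom) :
      (u s γ hγ).app k c = (u s (ρ ≫ γ) hγ').app k c := by
    rw [hu ρ γ hγ]
    exact congrArg ((u s γ hγ).app k) (cylS_map_retractionOnto c).symm
  have hρ : ρ ≫ γ = ρ ≫ γ' := SimplexCategory.Hom.ext _ _
    (OrderHom.ext _ _ (funext fun i => h _ (retractionOnto_mem _ _ i)))
  have hργ : ¬ Function.Surjective (ρ ≫ γ).toOrderHom := fun h => hγ fun a =>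
    (h a).elim fun b hb => ⟨_, hb⟩
  rw [key γ hγ hργ, key γ' hγ' (hρ ▸ hργ)]
  simp only [hρ]

lemma gluing_eq {s : SimplexCategory} {γ : s ⟶ n} (hγ : ¬ Function.Surjective γ.toOrderHom)
    {k : SimplexCategoryᵒᵖ} (c : ComposableArrows (maxCylinder s) k.unop.len)
    {d : ComposableArrows (maxCylinder n) k.unop.len} (hd : (cylS.map γ).app k c = d) :
    ∃ hρ, (u s γ hγ).app k c =
      (u n (retractionOnto (chainSupport d) (chainSupport_nonempty d)) hρ).app k d := by
  subst hd
  obtain ⟨a, ha⟩ := not_forall.1 hγ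
  have ha' : a ∉ chainSupport (m := n) ((cylS.map γ).app k c) := fun h => by
    obtain ⟨b, _, hb⟩ := (mem_chainSupport_cylS_map γ c).1 h
    exact ha ⟨b, hb⟩
  have hρ := not_surjective_retractionOnto ha'
  refine ⟨hρ, ?_⟩
  have hρ' : ¬ Function.Surjective (γ ≫ retractionOnto _ (chainSupport_nonempty (m := n)
      ((cylS.map γ).app k c))).toOrderHom := fun h => hρ fun a =>
    (h a).elim fun b hb => ⟨_, hb⟩
  rw [gluing_congr hu hγ hρ' c, hu γ _ hρ]
  · rfl
  · intro i hi
    exact (retractionOnto_of_mem _ _ ((mem_chainSupport_cylS_map γ c).2 ⟨i, hi, rfl⟩)).symm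

include hy

lemma GluingRel.unique {k : SimplexCategoryᵒᵖ} {c : (cylS.obj n).obj k} {v v' : K.obj k}
    (h : GluingRel y u k c v) (h' : GluingRel y u k c v') : v = v' := by
  obtain ⟨c₀, rfl, rfl⟩ | ⟨s, γ, hγ, d, hd, rfl⟩ := h
  · obtain ⟨c₁, hc, rfl⟩ | ⟨s, γ, hγ, d, hd, rfl⟩ := h'
    · rw [cylIncl_injective hc]
    · exact (gluing_eq_of_cylIncl hγ (hy γ hγ) d c₀ hd).symm
  · obtain ⟨c₁, rfl, rfl⟩ | ⟨s', γ', hγ', d', hd', rfl⟩ := h'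
    · exact gluing_eq_of_cylIncl hγ (hy γ hγ) d c₁ hd
    · exact (gluing_eq hu hγ d hd).choose_spec.trans (gluing_eq hu hγ' d' hd').choose_spec.symm

lemma exists_hom_nonFull : ∃ f : (nonFull n).toSSet ⟶ K,
    ∀ k c, GluingRel y u k c.1 (f.app k c) := by
  choose g hg using fun (k : SimplexCategoryᵒᵖ) (c : (nonFull n).obj k) =>
    exists_gluingRel (y := y) (u := u) c.2
  exact ⟨{ app := fun k => ↾(g k)
           naturality := fun k k' φ => ConcreteCategory.hom_ext _ _ fun c =>
            GluingRel.unique hu hy (hg k' _) ((hg k c).map φ) }, hg⟩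

/-- A map on `sd [n]` and compatible maps on the faces of the mapping cylinder extend to the
mapping cylinder if the target is a Kan complex. -/
lemma exists_gluing (hK : KanComplex K) : ∃ v : cylS.obj n ⟶ K, cylIncl.app n ≫ v = y ∧
    ∀ (s : SimplexCategory) (γ : s ⟶ n) hγ, cylS.map γ ≫ v = u s γ hγ := by
  obtain ⟨f, hf⟩ := exists_hom_nonFull @hu @hy
  obtain ⟨v, rfl⟩ := hK.exists_extension (anodyneExtensions_nonFull_ι n) f
  refine ⟨v, ?_, fun s γ hγ => ?_⟩
  · ext k c
    exact GluingRel.unique @hu @hy (hf k ⟨_, cylIncl_app_mem_nonFull c⟩) (.inl ⟨c, rfl, rfl⟩)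
  · ext k c
    exact GluingRel.unique @hu @hy (hf k ⟨_, cylS_map_app_mem_nonFull hγ c⟩)
      (.inr ⟨s, γ, hγ, c, rfl, rfl⟩)

end

end

lemma hasLiftingProperty_boundary_cylToEx {K : SSet.{0}} (hK : KanComplex K) (n : ℕ) :
    HasLiftingProperty (boundary n).ι (cylToEx K) where
  sq_hasLift := by
    intro b w sq
    let y : SdS.obj ⦋n⦌ ⟶ K := yonedaEquiv w
    let u (s : SimplexCategory) (γ : s ⟶ ⦋n⦌) (hγ : ¬ Function.Surjective γ.toOrderHom) :
        cylS.obj s ⟶ K := b.app (.op s) ⟨stdSimplex.objEquiv.symm γ, hγ⟩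
    obtain ⟨v, hv, hv'⟩ := exists_gluing (y := y) (u := u)
      (fun δ γ hγ hγ' => NatTrans.naturality_apply b δ.op
        (⟨stdSimplex.objEquiv.symm γ, hγ⟩ : (boundary n).obj _))
      (fun {s} γ hγ => by
        refine (ConcreteCategory.congr_hom (NatTrans.congr_app sq.w (.op s))
          ⟨stdSimplex.objEquiv.symm γ, hγ⟩).trans ?_
        exact congrArg (fun f : Δ[n] ⟶ Ex.obj K => f.app (.op s) (stdSimplex.objEquiv.symm γ))
          (SSet.yonedaEquiv.symm_apply_apply w).symm) hK
    refine ⟨⟨⟨yonedaEquiv.symm v, ?_, ?_⟩⟩⟩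
    · ext k ⟨x, hx⟩
      exact hv' k.unop (stdSimplex.objEquiv x) hx
    · apply yonedaEquiv.injective
      rw [yonedaEquiv_comp]
      exact (congrArg ((cylToEx K).app _) (SSet.yonedaEquiv.apply_symm_apply _)).trans hv

lemma hasLiftingProperty_mono_cylToEx {K : SSet.{0}} (hK : KanComplex K) {A B : SSet.{0}}
    (i : A ⟶ B) [Mono i] : HasLiftingProperty i (cylToEx K) := by
  have h : (MorphismProperty.monomorphisms SSet.{0}).rlp (cylToEx K) := by
    rw [rlp_monomorphisms]
    rintro _ _ _ ⟨n⟩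
    exact hasLiftingProperty_boundary_cylToEx hK n
  exact h i ‹_›

/-- The chain of the initial segments of `[m]`. -/
def initialChain (m : SimplexCategory) : ComposableArrows (sd m) m.len :=
  Monotone.functor (f := fun i => ⟨Finset.Iic i, Finset.nonempty_Iic⟩)
    fun _ _ h => Finset.Iic_subset_Iic.2 h

lemma maxChain_initialChain (m : SimplexCategory) : maxChain (initialChain m) = 𝟙 m :=
  SimplexCategory.Hom.ext _ _ (OrderHom.ext _ _ (funext fun _ => le_antisymm
    (Finset.max'_le _ Finset.nonempty_Iic _ fun _ h => Finset.mem_Iic.1 h)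
    (Finset.le_max' _ _ (Finset.mem_Iic.2 le_rfl))))

instance mono_nu (K : SSet.{0}) : Mono (nu K) := by
  rw [NatTrans.mono_iff_mono_app]
  intro k
  rw [mono_iff_injective]
  intro x y h
  have h' : K.map (maxChain (initialChain k.unop)).op x =
      K.map (maxChain (initialChain k.unop)).op y :=
    ConcreteCategory.congr_hom (NatTrans.congr_app h k) (initialChain k.unop)
  simpa [maxChain_initialChain] using h'

lemma exists_retraction_nu {K : SSet.{0}} (hK : KanComplex K) :
    ∃ r : Ex.obj K ⟶ K, nu K ≫ r = 𝟙 K := by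
  have := hasLiftingProperty_mono_cylToEx hK (nu K)
  have sq : CommSq (toCylEx K) (nu K) (cylToEx K) (𝟙 _) :=
    ⟨by rw [toCylEx_cylToEx, Category.comp_id]⟩
  exact ⟨sq.lift ≫ cylExEval K, by rw [sq.fac_left_assoc, toCylEx_cylExEval]⟩

end Paper

/-- For every simplicial set `X`, the unit map `ν_X : X ⟶ Ex X` is a
weak homotopy equivalence. -/
theorem nu_weakHomotopyEquivalence (X : SSet.{0}) :
    Paper.WeakHomotopyEquivalence (Paper.nu X) := by
  intro K hK
  obtain ⟨r, hr⟩ := Paper.exists_retraction_nu hK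
  exact Paper.homotopyEquivalence_pre_nu r hr X
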